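/- Let A > 0 and R > 0 be independent random variables on a common probability space satisfying lim_{r→∞} r^ρ P(R > r) = c_ρ and lim_{a→0+} a^{−κ} P(A ≤ a) = c_κ, where ρ > 0, κ > 0, c_ρ > 0, c_κ > 0 and 1 < ρ + κ < 2. Then lim_{x→∞} x^{ρ+κ} P( (1 − e^{−A R})/A > x ) = κ c_ρ c_κ ∫_0^1 (1−u)^{κ+ρ−1} ( log(1/u) )^{−ρ} du, and the integral on the right-hand side is finite. -/

import Mathlib

open MeasureTheory ProbabilityTheory Filter Set
open scoped Topology

noncomputable def Lf (y : ℝ) : ℝ := -Real.log (1 - y) / y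

lemma Lf_ge {y : ℝ} (h0 : 0 < y) (h1 : y < 1) : 1 ≤ Lf y := by
  unfold Lf
  rw [le_div_iff₀ h0]
  have := Real.log_le_sub_one_of_pos (x := 1 - y) (by linarith)
  linarith

lemma Lf_strict {y z : ℝ} (h0 : 0 < y) (hyz : y < z) (h1 : z < 1) : Lf y < Lf z := by
  unfold Lf
  have := strictConcaveOn_log_Ioi.secant_strict_mono (a := 1) (x := 1 - z) (y := 1 - y)
    (by simp) (by simp; linarith) (by simp; linarith) (by linarith) (by linarith) (by linarith)
  simp only [Real.log_one, sub_zero] at this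
  have e1 : Real.log (1 - y) / (1 - y - 1) = -Real.log (1 - y) / y := by
    rw [show 1 - y - 1 = -y by ring, div_neg, neg_div]
  have e2 : Real.log (1 - z) / (1 - z - 1) = -Real.log (1 - z) / z := by
    rw [show 1 - z - 1 = -z by ring, div_neg, neg_div]
  rwa [e1, e2] at this

lemma Lf_le_iff {y z : ℝ} (hy0 : 0 < y) (hy1 : y < 1) (hz0 : 0 < z) (hz1 : z < 1) :
    Lf y ≤ Lf z ↔ y ≤ z := by
  constructor
  · intro h
    by_contra! hc
    exact absurd (Lf_strict hz0 hc hy1) (not_lt.2 h)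
  · intro h
    rcases h.eq_or_lt with h | h
    · rw [h]
    · exact (Lf_strict hy0 h hz1).le

lemma Lf_surj {v : ℝ} (hv : 1 < v) : ∃ y, 0 < y ∧ y < 1 ∧ Lf y = v := by
  have hv0 : 0 < v := by linarith
  have hinv : v⁻¹ < 1 := inv_lt_one_of_one_lt₀ hv
  have hinv0 : 0 < v⁻¹ := inv_pos.2 hv0
  have he : Real.exp (-v) ≤ v⁻¹ := by
    rw [Real.exp_neg]
    exact inv_anti₀ hv0 (by linarith [Real.add_one_le_exp v])
  have hcont : ContinuousOn Lf (Icc (1 - v⁻¹) (1 - Real.exp (-v))) := by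
    intro y hy
    have h1 : 0 < y := by linarith [hy.1]
    have h2 : y < 1 := by linarith [hy.2, Real.exp_pos (-v)]
    unfold Lf
    apply ContinuousAt.continuousWithinAt
    apply ContinuousAt.div _ continuousAt_id h1.ne'
    apply ContinuousAt.neg
    apply ContinuousAt.log (by fun_prop) (by linarith)
  have := intermediate_value_Icc (by linarith) hcont
  obtain ⟨y, hy, hyv⟩ := this (show v ∈ _ by
    constructor
    · unfold Lf
      rw [div_le_iff₀ (by linarith), sub_sub_cancel, Real.log_inv, neg_neg, mul_sub,
        mul_inv_cancel₀ hv0.ne']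
      linarith [Real.log_le_sub_one_of_pos hv0]
    · unfold Lf
      have hlt : Real.exp (-v) < 1 := by linarith
      rw [le_div_iff₀ (by linarith), sub_sub_cancel, Real.log_exp]
      nlinarith [Real.exp_pos (-v)])
  exact ⟨y, by linarith [hy.1], by linarith [hy.2, Real.exp_pos (-v)], hyv⟩

lemma measurable_Lf : Measurable Lf := by unfold Lf; fun_prop

noncomputable def Gf (ρ : ℝ) : ℝ → ℝ := (Ioo (0:ℝ) 1).indicator (fun y => Lf y ^ (-ρ))

lemma measurable_Gf (ρ : ℝ) : Measurable (Gf ρ) :=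
  (measurable_Lf.pow_const _).indicator measurableSet_Ioo

lemma Gf_nonneg (ρ y : ℝ) : 0 ≤ Gf ρ y := by
  unfold Gf
  apply indicator_nonneg
  intro y hy
  have := Lf_ge hy.1 hy.2
  positivity

lemma Gf_le_one {ρ : ℝ} (hρ : 0 < ρ) (y : ℝ) : Gf ρ y ≤ 1 := by
  unfold Gf
  apply indicator_le' _ (by simp)
  intro y hy
  exact Real.rpow_le_one_of_one_le_of_nonpos (Lf_ge hy.1 hy.2) (by linarith)

lemma Gf_level {ρ t : ℝ} (hρ : 0 < ρ) (h0 : 0 < t) (h1 : t < 1) :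
    ∃ s, 0 < s ∧ s < 1 ∧ ∀ y, t ≤ Gf ρ y ↔ y ∈ Ioc 0 s := by
  have hv : 1 < t ^ (-ρ⁻¹) :=
    Real.one_lt_rpow_of_pos_of_lt_one_of_neg h0 h1 (by simpa using hρ)
  obtain ⟨s, hs0, hs1, hs⟩ := Lf_surj hv
  refine ⟨s, hs0, hs1, fun y => ?_⟩
  by_cases hy : y ∈ Ioo (0:ℝ) 1
  · have ht : t = Lf s ^ (-ρ) := by
      rw [hs, ← Real.rpow_mul h0.le]
      simp [hρ.ne']
    have := Lf_ge hy.1 hy.2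
    rw [Gf, indicator_of_mem hy, ht, Real.rpow_le_rpow_iff_of_neg (by rw [hs]; positivity)
      (by positivity) (by linarith), Lf_le_iff hy.1 hy.2 hs0 hs1]
    simp [hy.1]
  · rw [Gf, indicator_of_notMem hy]
    constructor
    · intro h; linarith
    · intro h; exact absurd ⟨h.1, h.2.trans_lt hs1⟩ hy

noncomputable def nuM (κ : ℝ) : Measure ℝ :=
  (volume.restrict (Ioo (0:ℝ) 1)).withDensity (fun y => ENNReal.ofReal (κ * y ^ (κ - 1)))

lemma nu_Ioc {κ s : ℝ} (hκ : 0 < κ) (hs0 : 0 < s) (hs1 : s ≤ 1) :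
    nuM κ (Ioo 0 s) = ENNReal.ofReal (s ^ κ) := by
  unfold nuM
  rw [withDensity_apply _ measurableSet_Ioo, Measure.restrict_restrict measurableSet_Ioo,
    inter_eq_left.2 (Ioo_subset_Ioo_right hs1), ← ofReal_integral_eq_lintegral_ofReal]
  · rw [← integral_Ioc_eq_integral_Ioo, ← intervalIntegral.integral_of_le hs0.le,
      intervalIntegral.integral_const_mul, integral_rpow (Or.inl (by linarith))]
    congr 1
    rw [sub_add_cancel, Real.zero_rpow hκ.ne']
    field_simp
    ring
  · have := (intervalIntegral.intervalIntegrable_rpow' (a := 0) (b := s)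
      (show -1 < κ - 1 by linarith)).const_mul κ
    rw [intervalIntegrable_iff_integrableOn_Ioo_of_le hs0.le] at this
    exact this
  · filter_upwards [ae_restrict_mem measurableSet_Ioo] with y hy
    have := hy.1
    simp only [Pi.zero_apply]
    positivity

lemma nu_Ioc' {κ s : ℝ} (hκ : 0 < κ) (hs0 : 0 < s) (hs1 : s ≤ 1) :
    (nuM κ).real (Ioc 0 s) = s ^ κ := by
  have hac : nuM κ ≪ volume :=
    (withDensity_absolutelyContinuous _ _).trans Measure.absolutelyContinuous_restrict
  rw [← measureReal_congr (hac.ae_eq (Ioo_ae_eq_Ioc (μ := volume) (a := 0) (b := s))),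
    measureReal_def, nu_Ioc hκ hs0 hs1, ENNReal.toReal_ofReal (by positivity)]

lemma nu_finite {κ : ℝ} (hκ : 0 < κ) : IsFiniteMeasure (nuM κ) := by
  constructor
  have : nuM κ univ = nuM κ (Ioo 0 1) := by
    unfold nuM
    rw [withDensity_apply _ MeasurableSet.univ, withDensity_apply _ measurableSet_Ioo,
      Measure.restrict_restrict measurableSet_Ioo]
    simp
  rw [this, nu_Ioc hκ one_pos le_rfl]
  exact ENNReal.ofReal_lt_top

/-- the weak-convergence step -/
lemma weak_step {Ω : Type*} [MeasurableSpace Ω] (P : Measure Ω) [IsProbabilityMeasure P]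
    (A : Ω → ℝ) (hAmeas : Measurable A) (hApos : ∀ᵐ ω ∂P, 0 < A ω)
    (ρ κ c_κ : ℝ) (hρ : 0 < ρ) (hκ : 0 < κ)
    (hx : ∀ s : ℝ, 0 < s → Tendsto (fun x : ℝ => x ^ κ * P.real {ω | A ω ≤ s / x}) atTop
      (𝓝 (c_κ * s ^ κ))) :
    Tendsto (fun x : ℝ => x ^ κ * ∫ ω, Gf ρ (x * A ω) ∂P) atTop
      (𝓝 (c_κ * ∫ y, Gf ρ y ∂(nuM κ))) := by
  have := nu_finite hκ
  have hint : ∀ x : ℝ, Integrable (fun ω => Gf ρ (x * A ω)) P := fun x =>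
    Integrable.of_bound
      ((measurable_Gf ρ).comp (hAmeas.const_mul x)).aestronglyMeasurable 1
      (ae_of_all _ fun ω => by
        rw [Real.norm_of_nonneg (Gf_nonneg _ _)]; exact Gf_le_one hρ _)
  have hint2 : Integrable (Gf ρ) (nuM κ) :=
    Integrable.of_bound (measurable_Gf ρ).aestronglyMeasurable 1
      (ae_of_all _ fun ω => by
        rw [Real.norm_of_nonneg (Gf_nonneg _ _)]; exact Gf_le_one hρ _)
  rw [hint2.integral_eq_integral_meas_le (ae_of_all _ fun y => Gf_nonneg _ _),
    ← integral_const_mul]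
  have e : ∀ x : ℝ, x ^ κ * ∫ ω, Gf ρ (x * A ω) ∂P =
      ∫ t in Ioi (0:ℝ), x ^ κ * P.real {ω | t ≤ Gf ρ (x * A ω)} := by
    intro x
    rw [(hint x).integral_eq_integral_meas_le (ae_of_all _ fun y => Gf_nonneg _ _),
      ← integral_const_mul]
  simp_rw [e]
  have hlev : ∀ t : ℝ, 0 < t → t < 1 → ∃ s, 0 < s ∧ s < 1 ∧ (nuM κ).real {y | t ≤ Gf ρ y} = s ^ κ ∧
      ∀ x : ℝ, 0 < x → P.real {ω | t ≤ Gf ρ (x * A ω)} = P.real {ω | A ω ≤ s / x} := by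
    intro t h0 h1
    obtain ⟨s, hs0, hs1, hs⟩ := Gf_level hρ h0 h1
    refine ⟨s, hs0, hs1, ?_, ?_⟩
    · rw [← nu_Ioc' hκ hs0 hs1.le]
      congr 1
      ext y
      exact hs y
    · intro x hx
      apply measureReal_congr
      filter_upwards [hApos] with ω hω
      apply propext
      change t ≤ Gf ρ (x * A ω) ↔ A ω ≤ s / x
      rw [hs, le_div_iff₀ hx, mul_comm x]
      simp only [mem_Ioc, mul_pos hω hx, true_and]
  have hne1 : ∀ᵐ t ∂(volume.restrict (Ioi (0:ℝ))), t ≠ 1 :=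
    ae_restrict_of_ae (by simp [ae_iff, measure_singleton])
  have hgt : ∀ t : ℝ, 1 < t → ∀ y, ¬ (t ≤ Gf ρ y) := fun t ht y h => by
    linarith [Gf_le_one hρ y]
  apply tendsto_integral_filter_of_dominated_convergence
    ((Ioc (0:ℝ) 1).indicator (fun _ => c_κ + 1))
  · refine Eventually.of_forall fun x => ?_
    apply Measurable.aestronglyMeasurable
    apply Measurable.const_mul
    apply Antitone.measurable
    intro t t' htt
    exact measureReal_mono (fun ω hω => le_trans htt hω)
  · have h1 := hx 1 one_pos
    rw [Real.one_rpow, mul_one] at h1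
    filter_upwards [h1.eventually_le_const (show c_κ < c_κ + 1 by linarith),
      eventually_gt_atTop 0] with x hx1 hx0
    filter_upwards [hne1, ae_restrict_mem measurableSet_Ioi] with t ht1 ht0
    rw [Real.norm_of_nonneg (by positivity)]
    rcases lt_or_gt_of_ne ht1 with h | h
    · obtain ⟨s, hs0, hs1, _, hs⟩ := hlev t ht0 h
      rw [indicator_of_mem (show t ∈ Ioc (0:ℝ) 1 from ⟨ht0, h.le⟩), hs x hx0]
      refine le_trans ?_ hx1
      gcongr
      exact measure_ne_top _ _
    · rw [indicator_of_notMem (fun hh => absurd hh.2 (not_le.2 h))]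
      simp [hgt t h]
  · rw [integrable_indicator_iff measurableSet_Ioc]
    apply integrableOn_const
    · refine ((Measure.restrict_apply_le _ _).trans_lt ?_).ne
      simp
    · simp
  · filter_upwards [hne1, ae_restrict_mem measurableSet_Ioi] with t ht1 ht0
    rcases lt_or_gt_of_ne ht1 with h | h
    · obtain ⟨s, hs0, hs1, hn, hs⟩ := hlev t ht0 h
      rw [hn]
      refine (hx s hs0).congr' ?_
      filter_upwards [eventually_gt_atTop 0] with x hx0
      rw [hs x hx0]
    · simp [hgt t h]

noncomputable def Ff (κ ρ : ℝ) (u : ℝ) : ℝ := (1 - u) ^ (κ + ρ - 1) * Real.log (1 / u) ^ (-ρ)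

lemma Ff_eq {κ ρ y : ℝ} (hκ : 0 < κ) (hy : y ∈ Ioo (0:ℝ) 1) :
    Gf ρ y * (ENNReal.ofReal (κ * y ^ (κ - 1))).toReal = κ * Ff κ ρ (1 - y) := by
  have h0 := hy.1
  have hl : 0 < -Real.log (1 - y) := by
    have := Real.log_neg (x := 1 - y) (by linarith [hy.2]) (by linarith)
    linarith
  rw [ENNReal.toReal_ofReal (by positivity), Gf, indicator_of_mem hy, Ff, Lf, one_div,
    Real.log_inv, sub_sub_cancel, Real.div_rpow hl.le h0.le, Real.rpow_neg h0.le ρ, div_inv_eq_mul,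
    show κ + ρ - 1 = ρ + (κ - 1) by ring, Real.rpow_add h0]
  ring

lemma Ff_int {κ ρ : ℝ} (hκ : 0 < κ) (hρ : 0 < ρ) :
    IntegrableOn (Ff κ ρ) (Ioo 0 1) ∧
      ∫ y, Gf ρ y ∂(nuM κ) = κ * ∫ u in Ioo (0:ℝ) 1, Ff κ ρ u := by
  have := nu_finite hκ
  have hint2 : Integrable (Gf ρ) (nuM κ) :=
    Integrable.of_bound (measurable_Gf ρ).aestronglyMeasurable 1
      (ae_of_all _ fun ω => by
        rw [Real.norm_of_nonneg (Gf_nonneg _ _)]; exact Gf_le_one hρ _)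
  have hm : Measurable (fun y : ℝ => ENNReal.ofReal (κ * y ^ (κ - 1))) := by fun_prop
  have hmp : MeasurePreserving (fun y : ℝ => 1 - y) volume volume :=
    Measure.measurePreserving_sub_left volume 1
  have hme : MeasurableEmbedding (fun y : ℝ => 1 - y) :=
    (MeasurableEquiv.subLeft (1:ℝ)).measurableEmbedding
  have hpre : (fun y : ℝ => 1 - y) ⁻¹' (Ioo 0 1) = Ioo 0 1 := by
    ext y
    simp only [mem_preimage, mem_Ioo]
    constructor <;> rintro ⟨h1, h2⟩ <;> constructor <;> linarith
  have hae : (fun y => Gf ρ y * (ENNReal.ofReal (κ * y ^ (κ - 1))).toReal) =ᵐ[volume.restrict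
      (Ioo (0:ℝ) 1)] fun y => κ * Ff κ ρ (1 - y) := by
    filter_upwards [ae_restrict_mem measurableSet_Ioo] with y hy using Ff_eq hκ hy
  constructor
  · unfold nuM at hint2
    rw [integrable_withDensity_iff hm (ae_of_all _ fun _ => ENNReal.ofReal_lt_top)] at hint2
    have h3 := hint2.congr hae
    rw [integrable_const_mul_iff hκ.ne'.isUnit] at h3
    rw [← hmp.integrableOn_comp_preimage hme, hpre]
    exact h3
  · unfold nuM
    rw [integral_withDensity_eq_integral_toReal_smul hm (ae_of_all _ fun _ => ENNReal.ofReal_lt_top),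
      ← hmp.setIntegral_preimage_emb hme (Ff κ ρ) (Ioo 0 1), hpre, ← integral_const_mul]
    refine integral_congr_ae (EventuallyEq.trans ?_ hae)
    exact ae_of_all _ fun y => by simp [mul_comm]

lemma event_iff {x a r : ℝ} (hx : 0 < x) (ha : 0 < a) (hr : 0 < r) :
    x < (1 - Real.exp (-(a * r))) / a ↔ (x * a ∈ Ioo (0:ℝ) 1 ∧ x * Lf (x * a) < r) := by
  have hxa : 0 < x * a := by positivity
  rw [lt_div_iff₀ ha, mem_Ioo]
  have key : x * a < 1 → (x * Lf (x * a) < r ↔ Real.exp (-(a * r)) < 1 - x * a) := by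
    intro h1
    have : x * Lf (x * a) = -Real.log (1 - x * a) / a := by
      unfold Lf; field_simp
    rw [this, div_lt_iff₀ ha, ← Real.lt_log_iff_exp_lt (by linarith), mul_comm a r]
    constructor <;> intro h <;> linarith
  constructor
  · intro h
    have h1 : x * a < 1 := by linarith [Real.exp_pos (-(a * r))]
    exact ⟨⟨hxa, h1⟩, (key h1).2 (by linarith)⟩
  · rintro ⟨⟨_, h1⟩, h2⟩
    linarith [(key h1).1 h2]

lemma prob_eq {Ω : Type*} [MeasurableSpace Ω] (P : Measure Ω) [IsProbabilityMeasure P]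
    (A R : Ω → ℝ) (hAmeas : Measurable A) (hRmeas : Measurable R)
    (hApos : ∀ᵐ ω ∂P, 0 < A ω) (hRpos : ∀ᵐ ω ∂P, 0 < R ω)
    (hindep : IndepFun A R P) {x : ℝ} (hx : 0 < x) :
    Measurable ((Ioo (0:ℝ) 1).indicator (fun y => P.real {ω | x * Lf y < R ω})) ∧
    P.real {ω | x < (1 - Real.exp (-(A ω * R ω))) / A ω} =
      ∫ ω, (Ioo (0:ℝ) 1).indicator (fun y => P.real {ω' | x * Lf y < R ω'}) (x * A ω) ∂P := by
  have hm0 : Measurable (fun r : ℝ => P.real {ω' | r < R ω'}) := by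
    apply Antitone.measurable
    intro t t' htt
    exact measureReal_mono (fun ω hω => lt_of_le_of_lt htt hω)
  have hm : Measurable ((Ioo (0:ℝ) 1).indicator (fun y => P.real {ω | x * Lf y < R ω})) :=
    (hm0.comp (measurable_Lf.const_mul x)).indicator measurableSet_Ioo
  refine ⟨hm, ?_⟩
  have e1 : P.real {ω | x < (1 - Real.exp (-(A ω * R ω))) / A ω} =
      P.real {ω | x * A ω ∈ Ioo (0:ℝ) 1 ∧ x * Lf (x * A ω) < R ω} := by
    apply measureReal_congr
    filter_upwards [hApos, hRpos] with ω h1 h2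
    exact propext (event_iff hx h1 h2)
  set S : Set (ℝ × ℝ) := {p | x * p.1 ∈ Ioo (0:ℝ) 1 ∧ x * Lf (x * p.1) < p.2} with hS
  have hSm : MeasurableSet S := by
    apply MeasurableSet.inter
    · exact (measurable_fst.const_mul x) measurableSet_Ioo
    · exact measurableSet_lt ((measurable_Lf.comp (measurable_fst.const_mul x)).const_mul x)
        measurable_snd
  have e2 : P {ω | x * A ω ∈ Ioo (0:ℝ) 1 ∧ x * Lf (x * A ω) < R ω} =
      P.map (fun ω => (A ω, R ω)) S := by
    rw [Measure.map_apply (hAmeas.prodMk hRmeas) hSm]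
    rfl
  have := Measure.isProbabilityMeasure_map (μ := P) hRmeas.aemeasurable
  rw [e1, measureReal_def, e2, (indepFun_iff_map_prod_eq_prod_map_map hAmeas.aemeasurable
    hRmeas.aemeasurable).1 hindep, Measure.prod_apply hSm,
    lintegral_map (measurable_measure_prodMk_left hSm) hAmeas,
    integral_eq_lintegral_of_nonneg_ae]
  · congr 1
    apply lintegral_congr
    intro ω
    rw [Measure.map_apply hRmeas (measurable_prodMk_left hSm)]
    by_cases h : x * A ω ∈ Ioo (0:ℝ) 1
    · rw [indicator_of_mem h, ofReal_measureReal]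
      congr 1
      ext ω'
      simp only [hS, mem_preimage, mem_ofPred_eq, h, true_and]
    · rw [indicator_of_notMem h, ENNReal.ofReal_zero]
      convert measure_empty (μ := P)
      ext ω'
      simp only [hS, mem_preimage, mem_ofPred_eq, h, false_and, mem_empty_iff_false]
  · exact ae_of_all _ fun ω => indicator_nonneg (fun _ _ => measureReal_nonneg) _
  · exact (hm.comp (hAmeas.const_mul x)).aestronglyMeasurable

lemma scaleA {f : ℝ → ℝ} {κ c : ℝ}
    (h : Tendsto (fun a : ℝ => a ^ (-κ) * f a) (𝓝[>] 0) (𝓝 c)) (s : ℝ) (hs : 0 < s) :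
    Tendsto (fun x : ℝ => x ^ κ * f (s / x)) atTop (𝓝 (c * s ^ κ)) := by
  have h1 : Tendsto (fun x : ℝ => s / x) atTop (𝓝[>] 0) := by
    apply tendsto_nhdsWithin_of_tendsto_nhds_of_eventually_within
    · exact tendsto_const_nhds.div_atTop tendsto_id
    · filter_upwards [eventually_gt_atTop 0] with x hx
      exact div_pos hs hx
  refine ((h.comp h1).mul_const (s ^ κ)).congr' ?_
  filter_upwards [eventually_gt_atTop 0] with x hx
  simp only [Function.comp]
  have hsp : 0 < s ^ κ := by positivity
  have hxp : 0 < x ^ κ := by positivity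
  rw [Real.rpow_neg (by positivity), Real.div_rpow hs.le hx.le]
  field_simp

lemma err_bound {Ω : Type*} [MeasurableSpace Ω] (P : Measure Ω) [IsProbabilityMeasure P]
    (R : Ω → ℝ) {ρ c ε x X y : ℝ} (hρ : 0 < ρ) (hε : 0 ≤ ε)
    (hX : ∀ r, X ≤ r → |r ^ ρ * P.real {ω | r < R ω} - c| ≤ ε) (hx : 0 < x) (hxX : X ≤ x)  :
    |x ^ ρ * (Ioo (0:ℝ) 1).indicator (fun y => P.real {ω' | x * Lf y < R ω'}) y - c * Gf ρ y| ≤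
      (Ioo (0:ℝ) 1).indicator (fun _ => ε) y := by
  by_cases hy : y ∈ Ioo (0:ℝ) 1
  · simp only [Gf, indicator_of_mem hy]
    have hL := Lf_ge hy.1 hy.2
    have hL0 : 0 < Lf y := by linarith
    have hLp : 0 < Lf y ^ ρ := by positivity
    have := hX (x * Lf y) (by nlinarith)
    have e : x ^ ρ * P.real {ω' | x * Lf y < R ω'} - c * Lf y ^ (-ρ) =
        Lf y ^ (-ρ) * ((x * Lf y) ^ ρ * P.real {ω' | x * Lf y < R ω'} - c) := by
      rw [Real.mul_rpow hx.le hL0.le, Real.rpow_neg hL0.le]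
      field_simp
    have h1 : Lf y ^ (-ρ) ≤ 1 := Real.rpow_le_one_of_one_le_of_nonpos hL (by linarith)
    have h0 : 0 ≤ Lf y ^ (-ρ) := by positivity
    rw [e, abs_mul, abs_of_nonneg h0]
    nlinarith
  · simp [Gf, indicator_of_notMem hy]

/-- tail of the total mass of the exponentially damped pulse. Let `A > 0`
and `R > 0` be independent with `r^ρ P(R > r) → c_ρ` (`r → ∞`) and
`a^{-κ} P(A ≤ a) → c_κ` (`a → 0+`), where `ρ, κ > 0`, `c_ρ, c_κ > 0`, `1 < ρ+κ < 2`. Then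
`x^{ρ+κ} P((1 - e^{-AR})/A > x) → κ c_ρ c_κ ∫_0^1 (1-u)^{κ+ρ-1} (log(1/u))^{-ρ} du`,
and the integral is finite. -/
theorem stmt_8 {Ω : Type*} [MeasurableSpace Ω] (P : Measure Ω) [IsProbabilityMeasure P]
    (A R : Ω → ℝ) (hAmeas : Measurable A) (hRmeas : Measurable R)
    (hApos : ∀ᵐ ω ∂P, 0 < A ω) (hRpos : ∀ᵐ ω ∂P, 0 < R ω)
    (hindep : IndepFun A R P)
    (ρ κ c_ρ c_κ : ℝ) (hρ : 0 < ρ) (hκ : 0 < κ) (hcρ : 0 < c_ρ) (hcκ : 0 < c_κ)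
    (hsum1 : 1 < ρ + κ) (hsum2 : ρ + κ < 2)
    (htailR : Tendsto (fun r : ℝ => r ^ ρ * (P {ω | r < R ω}).toReal) atTop (nhds c_ρ))
    (htailA : Tendsto (fun a : ℝ => a ^ (-κ) * (P {ω | A ω ≤ a}).toReal)
      (nhdsWithin 0 (Set.Ioi 0)) (nhds c_κ)) :
    IntegrableOn
      (fun u : ℝ => (1 - u) ^ (κ + ρ - 1) * Real.log (1 / u) ^ (-ρ)) (Set.Ioo 0 1) ∧
    Tendsto (fun x : ℝ =>
        x ^ (ρ + κ) *
          (P {ω | x < (1 - Real.exp (-(A ω * R ω))) / A ω}).toReal) atTop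
      (nhds (κ * c_ρ * c_κ *
        ∫ u in Set.Ioo (0:ℝ) 1, (1 - u) ^ (κ + ρ - 1) * Real.log (1 / u) ^ (-ρ))) := by
  have hA := scaleA htailA
  obtain ⟨hI, hE⟩ := Ff_int hκ hρ
  refine ⟨hI, ?_⟩
  have hW := weak_step P A hAmeas hApos ρ κ c_κ hρ hκ hA
  rw [hE] at hW
  have hW2 := hW.const_mul c_ρ
  have elim : c_ρ * (c_κ * (κ * ∫ u in Ioo (0:ℝ) 1, Ff κ ρ u)) = κ * c_ρ * c_κ *
        ∫ u in Set.Ioo (0:ℝ) 1, (1 - u) ^ (κ + ρ - 1) * Real.log (1 / u) ^ (-ρ) := by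
    simp only [Ff]; ring
  rw [elim] at hW2
  refine tendsto_of_tendsto_of_dist hW2 ?_
  rw [Metric.tendsto_nhds]
  intro δ hδ
  obtain ⟨ε, hε, hεδ⟩ : ∃ ε > 0, ε * (c_κ + 1) < δ :=
    ⟨δ / (2 * (c_κ + 1)), by positivity, by field_simp; norm_num⟩
  obtain ⟨X, hX⟩ := eventually_atTop.1 (Metric.tendsto_nhds.1 htailR ε hε)
  have h1 := hA 1 one_pos
  rw [Real.one_rpow, mul_one] at h1
  filter_upwards [h1.eventually_le_const (show c_κ < c_κ + 1 by linarith),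
      eventually_gt_atTop 0, eventually_ge_atTop X] with x hx1 hx0 hxX
  rw [Real.dist_0_eq_abs, abs_of_nonneg dist_nonneg, dist_comm, Real.dist_eq]
  refine lt_of_le_of_lt ?_ hεδ
  obtain ⟨hm, hp⟩ := prob_eq P A R hAmeas hRmeas hApos hRpos hindep hx0
  rw [← measureReal_def, hp]
  set H := (Ioo (0:ℝ) 1).indicator (fun y => P.real {ω' | x * Lf y < R ω'}) with hH
  have hHb : ∀ y, ‖H y‖ ≤ 1 := by
    intro y
    rw [hH, norm_indicator_eq_indicator_norm]
    refine indicator_le' (fun y _ => ?_) (fun _ _ => zero_le_one) y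
    rw [Real.norm_of_nonneg measureReal_nonneg]
    exact measureReal_le_one
  have hHi : Integrable (fun ω => H (x * A ω)) P :=
    Integrable.of_bound (hm.comp (hAmeas.const_mul x)).aestronglyMeasurable 1
      (ae_of_all _ fun ω => hHb _)
  have hGi : Integrable (fun ω => Gf ρ (x * A ω)) P :=
    Integrable.of_bound
      ((measurable_Gf ρ).comp (hAmeas.const_mul x)).aestronglyMeasurable 1
      (ae_of_all _ fun ω => by
        rw [Real.norm_of_nonneg (Gf_nonneg _ _)]; exact Gf_le_one hρ _)
  have e : x ^ (ρ + κ) * ∫ ω, H (x * A ω) ∂P - c_ρ * (x ^ κ * ∫ ω, Gf ρ (x * A ω) ∂P) =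
      x ^ κ * ∫ ω, (x ^ ρ * H (x * A ω) - c_ρ * Gf ρ (x * A ω)) ∂P := by
    rw [integral_sub (hHi.const_mul _) (hGi.const_mul _), integral_const_mul, integral_const_mul,
      Real.rpow_add hx0]
    ring
  have hmS : MeasurableSet {ω | A ω ≤ 1 / x} := measurableSet_le hAmeas measurable_const
  have hb : |∫ ω, (x ^ ρ * H (x * A ω) - c_ρ * Gf ρ (x * A ω)) ∂P| ≤
      ∫ ω, {ω | A ω ≤ 1 / x}.indicator (fun _ => ε) ω ∂P := by
    rw [← Real.norm_eq_abs]
    refine norm_integral_le_of_norm_le ((integrable_const (μ := P) ε).indicator hmS) (ae_of_all _ fun ω => ?_)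
    refine (err_bound P R hρ hε.le (fun r hr => (hX r hr).le) hx0 hxX).trans ?_
    by_cases hy : x * A ω ∈ Ioo (0:ℝ) 1
    · rw [indicator_of_mem hy, indicator_of_mem]
      change A ω ≤ 1 / x
      rw [le_div_iff₀ hx0, mul_comm]
      exact hy.2.le
    · rw [indicator_of_notMem hy]
      exact indicator_nonneg (fun _ _ => hε.le) _
  rw [integral_indicator_const _ hmS, smul_eq_mul] at hb
  rw [e, abs_mul, abs_of_nonneg (by positivity)]
  calc x ^ κ * |∫ ω, (x ^ ρ * H (x * A ω) - c_ρ * Gf ρ (x * A ω)) ∂P|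
      ≤ x ^ κ * (P.real {ω | A ω ≤ 1 / x} * ε) := by gcongr
    _ = ε * (x ^ κ * P.real {ω | A ω ≤ 1 / x}) := by ring
    _ ≤ ε * (c_κ + 1) := by gcongr; exact hx1
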